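/- arXiv:math/0209013 — 2 statements merged into one kernel-verified Lean document; each statement's English description precedes it below -/
import Mathlib

section
/- Let N ≥ 1 and k ≥ 2 be integers. Let X be a Hermitian complex N×N matrix and let Y₁, …, Y_k be skew-Hermitian complex N×N matrices with Y₁ + ⋯ + Y_k = 0. If not all of X, Y₁, …, Y_k are the zero matrix, then k·(k−1)·Tr(X²) − ∑_{i=1}^k Tr(Yᵢ²) is a positive real number. -/
open Matrix

/-- The squared Frobenius norm of a complex matrix, as a trace. -/
theorem trace_conjTranspose_mul_self_eq_sum_normSq {m n : Type*} [Fintype m] [Fintype n]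
    (A : Matrix m n ℂ) :
    (Aᴴ * A).trace = ((∑ j, ∑ i, Complex.normSq (A i j) : ℝ) : ℂ) := by
  simp [Matrix.trace, Matrix.mul_apply, Complex.normSq_eq_conj_mul_self]

theorem sum_normSq_nonneg {m n : Type*} [Fintype m] [Fintype n] (A : Matrix m n ℂ) :
    0 ≤ ∑ j, ∑ i, Complex.normSq (A i j) :=
  Finset.sum_nonneg fun _ _ => Finset.sum_nonneg fun _ _ => Complex.normSq_nonneg _

theorem sum_normSq_pos {m n : Type*} [Fintype m] [Fintype n] {A : Matrix m n ℂ} (hA : A ≠ 0) :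
    0 < ∑ j, ∑ i, Complex.normSq (A i j) := by
  obtain ⟨i, j, hij⟩ : ∃ i j, A i j ≠ 0 := by
    by_contra! h
    exact hA (Matrix.ext h)
  exact Finset.sum_pos' (fun _ _ => Finset.sum_nonneg fun _ _ => Complex.normSq_nonneg _)
    ⟨j, Finset.mem_univ j, Finset.sum_pos' (fun _ _ => Complex.normSq_nonneg _)
      ⟨i, Finset.mem_univ i, Complex.normSq_pos.mpr hij⟩⟩

/-- Positivity of the dual energy form `H⁻¹`: for `X` Hermitian and `Y i`
skew-Hermitian with `∑ Y i = 0`, not all zero,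
`k(k−1)·Tr(X²) − ∑ Tr(Yᵢ²)` is a positive real number. -/
theorem dual_energy_form_posdef (N k : ℕ) (hN : 1 ≤ N) (hk : 2 ≤ k)
    (X : Matrix (Fin N) (Fin N) ℂ) (hX : X.IsHermitian)
    (Y : Fin k → Matrix (Fin N) (Fin N) ℂ)
    (hY : ∀ i, (Y i)ᴴ = -(Y i)) (hsum : ∑ i, Y i = 0)
    (hne : ¬(X = 0 ∧ ∀ i, Y i = 0)) :
    ∃ r : ℝ, 0 < r ∧
      (k : ℂ) * ((k : ℂ) - 1) * (X * X).trace - ∑ i, (Y i * Y i).trace = (r : ℂ) := by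
  have hXX : (X * X).trace = ((∑ b, ∑ a, Complex.normSq (X a b) : ℝ) : ℂ) := by
    rw [← trace_conjTranspose_mul_self_eq_sum_normSq, hX.eq]
  have hYY (i : Fin k) :
      (Y i * Y i).trace = -((∑ b, ∑ a, Complex.normSq (Y i a b) : ℝ) : ℂ) := by
    rw [← trace_conjTranspose_mul_self_eq_sum_normSq, hY i, neg_mul, trace_neg, neg_neg]
  refine ⟨k * (k - 1) * (∑ b, ∑ a, Complex.normSq (X a b)) +
    ∑ i, ∑ b, ∑ a, Complex.normSq (Y i a b), ?_, ?_⟩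
  · have hk' : (2 : ℝ) ≤ k := by exact_mod_cast hk
    have hc : (0 : ℝ) < k * (k - 1) := mul_pos (by linarith) (by linarith)
    by_cases hX0 : X = 0
    · obtain ⟨i, hi⟩ : ∃ i, Y i ≠ 0 := by
        by_contra! h
        exact hne ⟨hX0, h⟩
      exact add_pos_of_nonneg_of_pos (mul_nonneg hc.le (sum_normSq_nonneg X))
        (Finset.sum_pos' (fun i _ => sum_normSq_nonneg (Y i))
          ⟨i, Finset.mem_univ i, sum_normSq_pos hi⟩)
    · exact add_pos_of_pos_of_nonneg (mul_pos hc (sum_normSq_pos hX0))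
        (Finset.sum_nonneg fun i _ => sum_normSq_nonneg (Y i))
  · simp only [hXX, hYY, Finset.sum_neg_distrib, sub_neg_eq_add]
    push_cast
    rfl
end

section
/- Let k ≥ 2 be an integer and let n be a real number with n > k − 1. Then ∑_{p=2}^{k} ∑_{q=0}^{k−p} (k! / (p! · q! · (k−p−q)!)) · (p−1)^q · (n−p+1)^{k−p−q−1} · ((n+1)·(p+q) − k·p) = k·(k−1)·n^{k−2}, where (n−p+1)^{k−p−q−1} is the real number n−p+1 (which is positive since n > k−1) raised to the integer power k−p−q−1 (this exponent equals −1 when p+q = k and is nonnegative otherwise). -/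
open Finset

/-- The first moment of the binomial expansion: `∑ q · C(m,q) x^q y^{m-q} = m x (x+y)^{m-1}`. -/
theorem sum_range_mul_choose_mul_pow {R : Type*} [CommSemiring R] (m : ℕ) (x y : R) :
    ∑ q ∈ Finset.range (m + 1), (q : R) * (m.choose q * (x ^ q * y ^ (m - q))) =
      m * x * (x + y) ^ (m - 1) := by
  cases m with
  | zero => simp
  | succ m =>
    rw [Finset.sum_range_succ', add_pow, Nat.add_sub_cancel, Finset.mul_sum]
    simp only [Nat.cast_zero, zero_mul, add_zero]
    refine Finset.sum_congr rfl fun q _ => ?_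
    have h : ((m + 1 : ℕ) : R) * m.choose q = (m + 1).choose (q + 1) * (q + 1 : ℕ) := by
      rw [← Nat.cast_mul, Nat.add_one_mul_choose_eq, Nat.cast_mul]
    rw [Nat.add_sub_add_right]
    calc _ = ((m + 1).choose (q + 1) * (q + 1 : ℕ) : R) * (x ^ (q + 1) * y ^ (m - q)) := by ring
      _ = _ := by rw [← h]; ring

/-- The inner sum, with `k = p + m`. -/
theorem sum_range_choose_mul_pow_mul_linear (p m : ℕ) (n : ℝ) (hy : n - p + 1 ≠ 0) :
    ∑ q ∈ Finset.range (m + 1), (m.choose q : ℝ) * ((p : ℝ) - 1) ^ q *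
        (n - p + 1) ^ ((m : ℤ) - q - 1) * ((n + 1) * ((p : ℝ) + q) - ((p : ℝ) + m) * p) =
      p * n ^ m - m * n ^ (m - 1) := by
  have hxy : ((p : ℝ) - 1) + (n - p + 1) = n := by ring
  have h0 := add_pow ((p : ℝ) - 1) (n - p + 1) m
  have h1 := sum_range_mul_choose_mul_pow m ((p : ℝ) - 1) (n - p + 1)
  rw [hxy] at h0 h1
  have hm : (m : ℝ) * n ^ m = m * (n * n ^ (m - 1)) := by
    cases m with
    | zero => simp
    | succ m => rw [Nat.add_sub_cancel, pow_succ']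
  apply mul_left_cancel₀ hy
  trans (p * (n + 1 - (p + m))) * n ^ m + (n + 1) * (m * ((p : ℝ) - 1) * n ^ (m - 1))
  · rw [← h1, h0, Finset.mul_sum, Finset.mul_sum, Finset.mul_sum, ← Finset.sum_add_distrib]
    refine Finset.sum_congr rfl fun q hq => ?_
    have hqm : q ≤ m := Nat.lt_succ_iff.mp (Finset.mem_range.mp hq)
    have hz : (n - p + 1) * (n - p + 1) ^ ((m : ℤ) - q - 1) = (n - p + 1) ^ (m - q) := by
      rw [← zpow_one_add₀ hy, ← zpow_natCast, Nat.cast_sub hqm]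
      congr 1
      ring
    rw [← hz]
    ring
  · linear_combination (-(p : ℝ)) * hm

/-- Closed-form evaluation of the double sum counting `(1,n)`-constellations:
`∑_{p=2}^{k} ∑_{q=0}^{k−p} (k!/(p!q!(k−p−q)!))·(p−1)^q·(n−p+1)^{k−p−q−1}
  ·((n+1)(p+q) − kp) = k(k−1)·n^{k−2}`. -/
theorem constellation_double_sum (k : ℕ) (hk : 2 ≤ k) (n : ℝ)
    (hn : (k : ℝ) - 1 < n) :
    ∑ p ∈ Finset.Icc 2 k, ∑ q ∈ Finset.range (k - p + 1),
      ((k.factorial : ℝ) / ((p.factorial : ℝ) * (q.factorial : ℝ) *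
          ((k - p - q).factorial : ℝ))) *
        ((p : ℝ) - 1) ^ q *
        (n - (p : ℝ) + 1) ^ ((k : ℤ) - (p : ℤ) - (q : ℤ) - 1) *
        ((n + 1) * ((p : ℝ) + (q : ℝ)) - (k : ℝ) * (p : ℝ)) =
    (k : ℝ) * ((k : ℝ) - 1) * n ^ (k - 2) := by
  let f : ℕ → ℝ := fun p => k.choose p * p * n ^ (k - p)
  have inner : ∀ p ∈ Finset.Ico 2 (k + 1), ∑ q ∈ Finset.range (k - p + 1),
      ((k.factorial : ℝ) / ((p.factorial : ℝ) * (q.factorial : ℝ) *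
          ((k - p - q).factorial : ℝ))) *
        ((p : ℝ) - 1) ^ q *
        (n - (p : ℝ) + 1) ^ ((k : ℤ) - (p : ℤ) - (q : ℤ) - 1) *
        ((n + 1) * ((p : ℝ) + (q : ℝ)) - (k : ℝ) * (p : ℝ)) = -(f (p + 1) - f p) := by
    intro p hp
    have hpk : p ≤ k := Nat.lt_succ_iff.mp (Finset.mem_Ico.mp hp).2
    have hpk' : (p : ℝ) ≤ k := by exact_mod_cast hpk
    have hy : n - p + 1 ≠ 0 := by linarith
    have hc : (k.choose (p + 1) : ℝ) * (p + 1 : ℕ) = k.choose p * (k - p : ℕ) := by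
      exact_mod_cast Nat.choose_succ_right_eq k p
    trans (k.choose p : ℝ) * (p * n ^ (k - p) - (k - p : ℕ) * n ^ (k - p - 1))
    · rw [← sum_range_choose_mul_pow_mul_linear p (k - p) n hy, Finset.mul_sum]
      refine Finset.sum_congr rfl fun q hq => ?_
      have hqm : q ≤ k - p := Nat.lt_succ_iff.mp (Finset.mem_range.mp hq)
      have hmul : (k.factorial : ℝ) / (p.factorial * q.factorial * (k - p - q).factorial) =
          k.choose p * (k - p).choose q := by
        rw [Nat.cast_choose ℝ hpk, Nat.cast_choose ℝ hqm]
        field_simp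
      rw [hmul, Nat.cast_sub hpk, Nat.cast_sub hpk]
      ring
    · simp only [f, hc, ← Nat.sub_sub]
      ring
  rw [← Finset.Ico_add_one_right_eq_Icc, Finset.sum_congr rfl inner, Finset.sum_neg_distrib,
    Finset.sum_Ico_sub f (by omega)]
  simp only [f, Nat.choose_succ_self, Nat.cast_choose_two]
  push_cast
  ring
end
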